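/- For every n ≥ 1, four times the number of interlacing triangular arrays of rank 3 and height n equals the number of proper vertex 4-colorings of the triangular grid graph Δ_n; that is, 4·|𝒯_{3,n}| = |{proper vertex 4-colorings of Δ_n}|. -/

import Mathlib

/-- Twice the horizontal coordinate `h(i,j,k) = i*n + j - (n+k)/2` of an entry
`T^(i)_(j,k)` of a triangular array of height `n` (doubled to stay in `ℤ`). -/
def Hc (n i j k : ℕ) : ℤ :=
  2 * ((i : ℤ) * (n : ℤ) + (j : ℤ)) - ((n : ℤ) + (k : ℤ))

/-- `T` is an interlacing triangular array of rank `m` and height `n`: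
entries `T i j k ∈ {1,…,m}` for `1 ≤ i ≤ m`, `1 ≤ j ≤ k ≤ n`;
(a) each value `a ∈ {1,…,m}` occurs exactly `k` times in row `k`;
(b) any two equal entries of row `k` have an interlacing equal entry in row `k-1`
strictly between them in horizontal coordinate. -/
def IsITA (m n : ℕ) (T : ℕ → ℕ → ℕ → ℕ) : Prop :=
  (∀ i j k, 1 ≤ i → i ≤ m → 1 ≤ j → j ≤ k → k ≤ n → T i j k ∈ Finset.Icc 1 m) ∧
  (∀ k, 1 ≤ k → k ≤ n → ∀ a ∈ Finset.Icc 1 m,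
      ((Finset.Icc 1 m ×ˢ Finset.Icc 1 k).filter (fun p => T p.1 p.2 k = a)).card = k) ∧
  (∀ k, 1 ≤ k → k ≤ n → ∀ i j i' j',
      1 ≤ i → i ≤ m → 1 ≤ j → j ≤ k → 1 ≤ i' → i' ≤ m → 1 ≤ j' → j' ≤ k →
      T i j k = T i' j' k → Hc n i j k < Hc n i' j' k →
      ∃ i'' j'', 1 ≤ i'' ∧ i'' ≤ m ∧ 1 ≤ j'' ∧ j'' ≤ k - 1 ∧
        T i'' j'' (k - 1) = T i j k ∧
        Hc n i j k < Hc n i'' j'' (k - 1) ∧ Hc n i'' j'' (k - 1) < Hc n i' j' k)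

/-- The set of interlacing triangular arrays of rank `m` and height `n`,
normalized to be `0` outside the support `1 ≤ i ≤ m`, `1 ≤ j ≤ k ≤ n`. -/
def ITAFull (m n : ℕ) : Set (ℕ → ℕ → ℕ → ℕ) :=
  {T | IsITA m n T ∧ ∀ i j k, ¬(1 ≤ i ∧ i ≤ m ∧ 1 ≤ j ∧ j ≤ k ∧ k ≤ n) → T i j k = 0}

/-- Proper vertex `4`-colorings of `Δ_n` (colors `{0,1,2,3}`), normalized to `0`
outside the vertex set. -/
def ColorAll (n : ℕ) : Set (ℕ × ℕ → ℕ) :=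
  {C | (∀ x y, x + y ≤ n → C (x, y) < 4) ∧
       (∀ x y, x + y < n →
          C (x, y) ≠ C (x + 1, y) ∧ C (x, y) ≠ C (x, y + 1) ∧
          C (x + 1, y) ≠ C (x, y + 1)) ∧
       (∀ x y, ¬(x + y ≤ n) → C (x, y) = 0)}

open Finset

/-- number of entries `a` in row `k` that are lexicographically at most `(i,j)`. -/
def cntL (T : ℕ → ℕ → ℕ → ℕ) (a k i j : ℕ) : ℕ :=
  ((Finset.Icc 1 3 ×ˢ Finset.Icc 1 k).filter
    (fun p => T p.1 p.2 k = a ∧ (p.1 < i ∨ (p.1 = i ∧ p.2 ≤ j)))).card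

lemma cntL_zero (T : ℕ → ℕ → ℕ → ℕ) (a k : ℕ) : cntL T a k 1 0 = 0 := by
  unfold cntL
  rw [Finset.card_eq_zero, Finset.filter_eq_empty_iff]
  rintro ⟨x, y⟩ h
  simp only [mem_product, mem_Icc] at h
  simp only
  omega

lemma cntL_next (T : ℕ → ℕ → ℕ → ℕ) (a k i : ℕ) : cntL T a k (i+1) 0 = cntL T a k i k := by
  unfold cntL
  congr 1
  apply Finset.filter_congr
  rintro ⟨x, y⟩ h
  simp only [mem_product, mem_Icc] at h
  simp only
  constructor <;> rintro ⟨h1, h2⟩ <;> refine ⟨h1, ?_⟩ <;> omega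

lemma cntL_total (T : ℕ → ℕ → ℕ → ℕ) (a k : ℕ) : cntL T a k 3 k =
    ((Finset.Icc 1 3 ×ˢ Finset.Icc 1 k).filter (fun p => T p.1 p.2 k = a)).card := by
  unfold cntL
  congr 1
  apply Finset.filter_congr
  rintro ⟨x, y⟩ h
  simp only [mem_product, mem_Icc] at h
  simp only
  constructor
  · rintro ⟨h1, h2⟩; exact h1
  · intro h1; refine ⟨h1, ?_⟩; omega

lemma cntL_succ (T : ℕ → ℕ → ℕ → ℕ) (a k i j : ℕ) (hi : 1 ≤ i) (hi3 : i ≤ 3) (hj : j + 1 ≤ k) :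
    cntL T a k i (j+1) = cntL T a k i j + if T i (j+1) k = a then 1 else 0 := by
  unfold cntL
  split_ifs with h
  · rw [← Finset.card_insert_of_notMem (a := (i, j+1))]
    · congr 1
      ext ⟨x, y⟩
      simp only [mem_filter, mem_product, mem_Icc, mem_insert, Prod.mk.injEq]
      constructor
      · rintro ⟨h1, h2, h3⟩
        by_cases h4 : x = i ∧ y = j + 1
        · exact Or.inl h4
        · right; refine ⟨h1, h2, ?_⟩; omega
      · rintro (⟨rfl, rfl⟩ | ⟨h1, h2, h3⟩)
        · refine ⟨by omega, h, by omega⟩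
        · refine ⟨h1, h2, by omega⟩
    · simp
  · rw [add_zero]
    congr 1
    apply Finset.filter_congr
    rintro ⟨x, y⟩ h'
    simp only
    constructor
    · rintro ⟨h1, h2⟩
      refine ⟨h1, ?_⟩
      by_contra h3
      have h4 : x = i ∧ y = j + 1 := by omega
      rw [h4.1, h4.2] at h1
      exact h h1
    · rintro ⟨h1, h2⟩
      exact ⟨h1, by omega⟩

lemma cntL_row0 (T : ℕ → ℕ → ℕ → ℕ) (a i j : ℕ) : cntL T a 0 i j = 0 := by
  simp [cntL]

/-- order of positions in the same row -/
lemma Hc_lt_same (n i j i' j' k : ℕ) (hi : 1 ≤ i) (hi3 : i ≤ 3) (hi' : 1 ≤ i') (hi3' : i' ≤ 3)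
    (hj : 1 ≤ j) (hjk : j ≤ k) (hj' : 1 ≤ j') (hjk' : j' ≤ k) (hk : k ≤ n) :
    Hc n i j k < Hc n i' j' k ↔ (i < i' ∨ (i = i' ∧ j < j')) := by
  unfold Hc
  interval_cases i <;> interval_cases i' <;> omega

lemma Hc_lt_up (n i j i' j' m : ℕ) (hi : 1 ≤ i) (hi3 : i ≤ 3) (hi' : 1 ≤ i') (hi3' : i' ≤ 3)
    (hj : 1 ≤ j) (hjk : j ≤ m + 1) (hj' : 1 ≤ j') (hjk' : j' ≤ m) (hk : m + 1 ≤ n) :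
    Hc n i j (m + 1) < Hc n i' j' m ↔ (i < i' ∨ (i = i' ∧ j ≤ j')) := by
  unfold Hc
  interval_cases i <;> interval_cases i' <;> omega

lemma Hc_lt_dn (n i j i' j' m : ℕ) (hi : 1 ≤ i) (hi3 : i ≤ 3) (hi' : 1 ≤ i') (hi3' : i' ≤ 3)
    (hj : 1 ≤ j) (hjk : j ≤ m) (hj' : 1 ≤ j') (hjk' : j' ≤ m + 1) (hk : m + 1 ≤ n) :
    Hc n i j m < Hc n i' j' (m + 1) ↔ (i < i' ∨ (i = i' ∧ j < j')) := by
  unfold Hc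
  interval_cases i <;> interval_cases i' <;> omega

/-- The ballot-type bounds between rows `m` and `m+1`. -/
def RowBd (T : ℕ → ℕ → ℕ → ℕ) (m : ℕ) : Prop :=
  ∀ a, 1 ≤ a → a ≤ 3 → ∀ i, 1 ≤ i → i ≤ 3 → ∀ j, j ≤ m →
    cntL T a m i j ≤ cntL T a (m+1) i j ∧ cntL T a (m+1) i (j+1) ≤ cntL T a m i j + 1

lemma injOn_Hc (n k : ℕ) (hk : k ≤ n) (s : Finset (ℕ × ℕ)) (hs : s ⊆ Finset.Icc 1 3 ×ˢ Finset.Icc 1 k) :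
    Set.InjOn (fun p : ℕ × ℕ => Hc n p.1 p.2 k) s := by
  rintro ⟨i, j⟩ h ⟨i', j'⟩ h' he
  have h1 := hs h
  have h2 := hs h'
  simp only [mem_product, mem_Icc] at h1 h2
  simp only at he
  have h3 := Hc_lt_same n i j i' j' k (by omega) (by omega) (by omega) (by omega) (by omega) (by omega) (by omega) (by omega) hk
  have h4 := Hc_lt_same n i' j' i j k (by omega) (by omega) (by omega) (by omega) (by omega) (by omega) (by omega) (by omega) hk
  rw [he] at h3 h4
  simp only [lt_irrefl, false_iff] at h3 h4
  ext <;> simp only <;> omega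

/-- number of entries `a` in row `k` that are lexicographically after `(i,j)`. -/
lemma cntL_compl (T : ℕ → ℕ → ℕ → ℕ) (a k i j : ℕ) :
  ((Finset.Icc 1 3 ×ˢ Finset.Icc 1 k).filter (fun p => T p.1 p.2 k = a)).card =
    cntL T a k i j + ((Finset.Icc 1 3 ×ˢ Finset.Icc 1 k).filter
    (fun p => T p.1 p.2 k = a ∧ ¬ (p.1 < i ∨ (p.1 = i ∧ p.2 ≤ j)))).card := by
  unfold cntL
  rw [← Finset.card_filter_add_card_filter_not (s := (Finset.Icc 1 3 ×ˢ Finset.Icc 1 k).filter (fun p => T p.1 p.2 k = a)) (fun p => (p.1 < i ∨ (p.1 = i ∧ p.2 ≤ j)))]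
  rw [Finset.filter_filter, Finset.filter_filter]

lemma ITA_bd (n : ℕ) (T : ℕ → ℕ → ℕ → ℕ) (hT : IsITA 3 n T) (m : ℕ) (hm : m + 1 ≤ n) :
    RowBd T m := by
  obtain ⟨hv, hc, hI⟩ := hT
  have key : ∀ a, ∀ P Q : ℕ × ℕ → Prop, ∀ _ : DecidablePred P, ∀ _ : DecidablePred Q,
      (∀ i j i' j' i'' j'', P (i, j) → P (i', j') → (i < i'' ∨ (i = i'' ∧ j ≤ j'')) →
        (i'' < i' ∨ (i'' = i' ∧ j'' < j')) → Q (i'', j'')) →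
      ((Finset.Icc 1 3 ×ˢ Finset.Icc 1 (m+1)).filter (fun p => T p.1 p.2 (m+1) = a ∧ P p)).card ≤
      ((Finset.Icc 1 3 ×ˢ Finset.Icc 1 m).filter (fun p => T p.1 p.2 m = a ∧ Q p)).card + 1 := by
    intro a P Q _ _ hPQ
    rw [← Finset.card_image_of_injOn (injOn_Hc n (m+1) hm _ (Finset.filter_subset _ _)),
      ← Finset.card_image_of_injOn (injOn_Hc n m (by omega) _ (Finset.filter_subset _ _))]
    apply Finset.card_le_of_interleaved
    intro x hx y hy hxy _
    simp only [mem_image, mem_filter, mem_product, mem_Icc] at hx hy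
    obtain ⟨⟨i, j⟩, ⟨h1, h2, h3⟩, rfl⟩ := hx
    obtain ⟨⟨i', j'⟩, ⟨h1', h2', h3'⟩, rfl⟩ := hy
    simp only at *
    obtain ⟨i'', j'', g1, g2, g3, g4, g5, g6, g7⟩ := hI (m+1) (by omega) hm i j i' j' (by omega) (by omega) (by omega)
      (by omega) (by omega) (by omega) (by omega) (by omega) (by omega) hxy
    simp only [Nat.add_sub_cancel] at g4 g5 g6 g7
    refine ⟨_, ?_, g6, g7⟩
    rw [Hc_lt_up] at g6 <;> try omega
    rw [Hc_lt_dn] at g7 <;> try omega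
    simp only [mem_image, mem_filter, mem_product, mem_Icc]
    exact ⟨(i'', j''), ⟨by simp only; omega, by simp only; omega, hPQ i j i' j' i'' j'' h3 h3' g6 g7⟩, rfl⟩
  intro a ha ha3 i hi hi3 j hj
  constructor
  · have h := key a (fun p => ¬ (p.1 < i ∨ (p.1 = i ∧ p.2 ≤ j))) (fun p => ¬ (p.1 < i ∨ (p.1 = i ∧ p.2 ≤ j)))
      inferInstance inferInstance (by intros; simp only at *; omega)
    have e1 := cntL_compl T a (m+1) i j
    have e2 := cntL_compl T a m i j
    have e3 := hc (m+1) (by omega) hm a (by simp; omega)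
    have e4 : ((Finset.Icc 1 3 ×ˢ Finset.Icc 1 m).filter (fun p => T p.1 p.2 m = a)).card = m := by
      rcases Nat.eq_zero_or_pos m with rfl | hm0
      · simp
      · exact hc m hm0 (by omega) a (by simp; omega)
    omega
  · exact key a (fun p => (p.1 < i ∨ (p.1 = i ∧ p.2 ≤ j+1))) (fun p => (p.1 < i ∨ (p.1 = i ∧ p.2 ≤ j)))
      inferInstance inferInstance (by intros; simp only at *; omega)

lemma bd_ITA (n : ℕ) (T : ℕ → ℕ → ℕ → ℕ)
    (hv : ∀ i j k, 1 ≤ i → i ≤ 3 → 1 ≤ j → j ≤ k → k ≤ n → T i j k ∈ Finset.Icc 1 3)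
    (hb : ∀ m, m + 1 ≤ n → RowBd T m)
    (ht : ∀ m, m + 1 ≤ n → ∀ a, 1 ≤ a → a ≤ 3 → cntL T a (m+1) 3 (m+1) = cntL T a m 3 m + 1) :
    IsITA 3 n T := by
  refine ⟨hv, ?_, ?_⟩
  · have : ∀ k, k ≤ n → ∀ a ∈ Finset.Icc 1 3, cntL T a k 3 k = k := by
      intro k
      induction k with
      | zero => intros; simp [cntL]
      | succ m ih =>
        intro hm a ha
        have := ih (by omega) a ha
        rw [mem_Icc] at ha
        rw [ht m hm a ha.1 ha.2, this]
    intro k _ hk a ha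
    rw [← cntL_total]
    exact this k hk a ha
  · intro k hk1 hk i j i' j' hi hi3 hj hjk hi' hi3' hj' hjk' hTT hlt
    obtain ⟨m, rfl⟩ : ∃ m, k = m + 1 := ⟨k - 1, by omega⟩
    simp only [Nat.add_sub_cancel]
    rw [Hc_lt_same] at hlt <;> try omega
    by_contra hcon
    push Not at hcon
    have hva := hv i j (m+1) hi hi3 hj hjk hk
    rw [mem_Icc] at hva
    have b1 := (hb m hk _ hva.1 hva.2 i hi hi3 (j-1) (by omega)).1
    have b2 := (hb m hk _ hva.1 hva.2 i' hi' hi3' (j'-1) (by omega)).2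
    rw [Nat.sub_add_cancel hj'] at b2
    set a := T i j (m+1) with ha
    have e1 : cntL T a m i' (j'-1) ≤ cntL T a m i (j-1) := by
      apply Finset.card_le_card
      rintro ⟨x, y⟩ hx
      simp only [mem_filter, mem_product, mem_Icc] at hx ⊢
      refine ⟨hx.1, hx.2.1, ?_⟩
      by_contra hne
      have h7 := hcon x y (by omega) (by omega) (by omega) (by omega) (by omega)
      rw [Hc_lt_up] at h7 <;> try omega
      have h8 := h7 (by omega)
      rw [← not_lt, Hc_lt_dn] at h8 <;> omega
    have e2 : cntL T a (m+1) i (j-1) + 2 ≤ cntL T a (m+1) i' j' := by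
      have : cntL T a (m+1) i' j' ≥ (insert (i,j) (insert (i',j') ((Finset.Icc 1 3 ×ˢ Finset.Icc 1 (m+1)).filter
    (fun p => T p.1 p.2 (m+1) = a ∧ (p.1 < i ∨ (p.1 = i ∧ p.2 ≤ j-1)))))).card := by
        apply Finset.card_le_card
        rintro ⟨x, y⟩ hx
        simp only [mem_filter, mem_product, mem_Icc, mem_insert, Prod.mk.injEq] at hx ⊢
        rcases hx with ⟨rfl, rfl⟩ | ⟨rfl, rfl⟩ | hx
        · refine ⟨by omega, rfl, by omega⟩
        · refine ⟨by omega, hTT.symm, by omega⟩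
        · refine ⟨hx.1, hx.2.1, by omega⟩
      rw [Finset.card_insert_of_notMem, Finset.card_insert_of_notMem] at this
      · exact this
      · simp only [mem_filter]; omega
      · simp only [mem_filter, mem_insert, Prod.mk.injEq]; omega
    omega

/-- indicator -/
def dl (x a : ℕ) : ℕ := if x = a then 1 else 0

lemma cntL_succ' (T : ℕ → ℕ → ℕ → ℕ) (a k i j : ℕ) (hi : 1 ≤ i) (hi3 : i ≤ 3) (hj : j + 1 ≤ k) :
    cntL T a k i (j+1) = cntL T a k i j + dl (T i (j+1) k) a := cntL_succ T a k i j hi hi3 hj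

/-- Local structure of two consecutive rows. -/
structure RowStr (T : ℕ → ℕ → ℕ → ℕ) (m : ℕ) (s : ℕ → ℕ) : Prop where
  s0 : s 0 = T 1 (m+1) (m+1)
  b1 : ∀ j, j < m → T 1 (j+1) (m+1) = T 1 (j+1) m
  b2 : ∀ j, j < m → s (j+1) = s j ^^^ T 2 (j+1) (m+1) ^^^ T 2 (j+1) m
  sv : ∀ j, j ≤ m → 1 ≤ s j ∧ s j ≤ 3 ∧ s j ≠ T 2 (j+1) (m+1)
  b30 : T 3 1 (m+1) = s m ^^^ T 2 (m+1) (m+1)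
  b3 : ∀ j, j < m → T 3 (j+2) (m+1) = T 3 (j+1) m

/-- entries of row `k` lie in `{1,2,3}` -/
def RowVal (T : ℕ → ℕ → ℕ → ℕ) (k : ℕ) : Prop :=
  ∀ i j, 1 ≤ i → i ≤ 3 → 1 ≤ j → j ≤ k → 1 ≤ T i j k ∧ T i j k ≤ 3

lemma xor_step (s w u : ℕ) (hs : 1 ≤ s ∧ s ≤ 3) (hw : 1 ≤ w ∧ w ≤ 3)
    (h : u = s ∨ u = w) :
    (1 ≤ s ^^^ w ^^^ u ∧ s ^^^ w ^^^ u ≤ 3) ∧ ∀ a, dl s a + dl w a = dl u a + dl (s ^^^ w ^^^ u) a := by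
  rcases h with rfl | rfl
  · have : u ^^^ w ^^^ u = w := by rw [Nat.xor_comm u w, Nat.xor_assoc, Nat.xor_self, Nat.xor_zero]
    rw [this]; exact ⟨hw, fun a => rfl⟩
  · have : s ^^^ u ^^^ u = s := by rw [Nat.xor_assoc, Nat.xor_self, Nat.xor_zero]
    rw [this]; exact ⟨hs, fun a => by omega⟩

lemma xor_third (s w c : ℕ) (hs : 1 ≤ s ∧ s ≤ 3) (hw : 1 ≤ w ∧ w ≤ 3) (hc : 1 ≤ c ∧ c ≤ 3)
    (h1 : s ≠ w) (h2 : c ≠ s) (h3 : c ≠ w) : c = s ^^^ w := by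
  obtain ⟨a, b⟩ := hs; obtain ⟨a', b'⟩ := hw; obtain ⟨a'', b''⟩ := hc
  interval_cases s <;> interval_cases w <;> interval_cases c <;> simp_all

lemma xor_two (s w u t : ℕ) (hs : 1 ≤ s ∧ s ≤ 3) (hw : 1 ≤ w ∧ w ≤ 3) (hu : 1 ≤ u ∧ u ≤ 3)
    (ht : 1 ≤ t ∧ t ≤ 3) (h1 : s ≠ w) (h : t = s ^^^ w ^^^ u) : u = s ∨ u = w := by
  obtain ⟨a, b⟩ := hs; obtain ⟨a', b'⟩ := hw; obtain ⟨a'', b''⟩ := hu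
  interval_cases s <;> interval_cases w <;> interval_cases u <;> simp_all

lemma dl_third (s w : ℕ) (hs : 1 ≤ s ∧ s ≤ 3) (hw : 1 ≤ w ∧ w ≤ 3) (h1 : s ≠ w) (a : ℕ) (ha : 1 ≤ a) (ha' : a ≤ 3) :
    dl s a + dl w a + dl (s ^^^ w) a = 1 := by
  obtain ⟨p, q⟩ := hs; obtain ⟨p', q'⟩ := hw
  interval_cases s <;> interval_cases w <;> interval_cases a <;> simp_all [dl]

@[simp] lemma dl_self (a : ℕ) : dl a a = 1 := by simp [dl]
lemma dl_le (x a : ℕ) : dl x a ≤ 1 := by unfold dl; split_ifs <;> omega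
lemma dl_pos (x a : ℕ) (h : 1 ≤ dl x a) : x = a := by
  unfold dl at h; split_ifs at h <;> omega

/-- bounds imply structure -/
lemma bd_str (T : ℕ → ℕ → ℕ → ℕ) (m : ℕ) (hb : RowBd T m) (hu : RowVal T m) (hw : RowVal T (m+1))
    (s : ℕ → ℕ) (s0 : s 0 = T 1 (m+1) (m+1))
    (b2 : ∀ j, j < m → s (j+1) = s j ^^^ T 2 (j+1) (m+1) ^^^ T 2 (j+1) m) :
    RowStr T m s := by
  have c1 : ∀ j, j ≤ m → (∀ a, 1 ≤ a → a ≤ 3 → cntL T a (m+1) 1 j = cntL T a m 1 j) ∧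
      (∀ i, i < j → T 1 (i+1) (m+1) = T 1 (i+1) m) := by
    intro j
    induction j with
    | zero => intro _; exact ⟨fun a _ _ => by rw [cntL_zero, cntL_zero], fun i hi => by omega⟩
    | succ j ih =>
      intro hj
      obtain ⟨ih1, ih2⟩ := ih (by omega)
      have hvu := hu 1 (j+1) le_rfl (by omega) (by omega) hj
      have e : T 1 (j+1) (m+1) = T 1 (j+1) m := by
        have h1 := (hb _ hvu.1 hvu.2 1 le_rfl (by omega) (j+1) hj).1
        rw [cntL_succ' _ _ _ _ _ le_rfl (by omega) (by omega), cntL_succ' _ _ _ _ _ le_rfl (by omega) (by omega),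
          ih1 _ hvu.1 hvu.2, dl_self] at h1
        exact dl_pos _ _ (by omega)
      refine ⟨fun a ha ha3 => ?_, fun i hi => ?_⟩
      · rw [cntL_succ' _ _ _ _ _ le_rfl (by omega) (by omega), cntL_succ' _ _ _ _ _ le_rfl (by omega) (by omega),
          ih1 _ ha ha3, e]
      · rcases Nat.lt_succ_iff_lt_or_eq.mp hi with h | rfl
        · exact ih2 i h
        · exact e
  have c2 : ∀ j, j ≤ m → (1 ≤ s j ∧ s j ≤ 3 ∧ s j ≠ T 2 (j+1) (m+1)) ∧
      (∀ a, 1 ≤ a → a ≤ 3 → cntL T a (m+1) 2 j = cntL T a m 2 j + dl (s j) a) := by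
    have aux : ∀ j, j ≤ m → (1 ≤ s j ∧ s j ≤ 3) →
      (∀ a, 1 ≤ a → a ≤ 3 → cntL T a (m+1) 2 j = cntL T a m 2 j + dl (s j) a) →
      s j ≠ T 2 (j+1) (m+1) := by
      intro j hj h1 h2 he
      have hvw := hw 2 (j+1) (by omega) (by omega) (by omega) (by omega)
      have h3 := (hb _ hvw.1 hvw.2 2 (by omega) (by omega) j hj).2
      rw [cntL_succ' _ _ _ _ _ (by omega) (by omega) (by omega), h2 _ hvw.1 hvw.2, he, dl_self] at h3
      omega
    intro j
    induction j with
    | zero =>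
      intro _
      have h1 : 1 ≤ s 0 ∧ s 0 ≤ 3 := by rw [s0]; exact hw 1 (m+1) le_rfl (by omega) (by omega) le_rfl
      have h2 : ∀ a, 1 ≤ a → a ≤ 3 → cntL T a (m+1) 2 0 = cntL T a m 2 0 + dl (s 0) a := by
        intro a ha ha3
        rw [cntL_next, cntL_next, cntL_succ' _ _ _ _ _ le_rfl (by omega) (by omega), (c1 m le_rfl).1 a ha ha3, s0]
      exact ⟨⟨h1.1, h1.2, aux 0 (by omega) h1 h2⟩, h2⟩
    | succ j ih =>
      intro hj
      obtain ⟨⟨i1, i2, i3⟩, ih⟩ := ih (by omega)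
      have hvu := hu 2 (j+1) (by omega) (by omega) (by omega) hj
      have hvw := hw 2 (j+1) (by omega) (by omega) (by omega) (by omega)
      have h3 := (hb _ hvu.1 hvu.2 2 (by omega) (by omega) (j+1) hj).1
      rw [cntL_succ' _ _ _ _ _ (by omega) (by omega) (by omega), cntL_succ' _ _ _ _ _ (by omega) (by omega) (by omega), ih _ hvu.1 hvu.2, dl_self] at h3
      have h4 : T 2 (j+1) m = s j ∨ T 2 (j+1) m = T 2 (j+1) (m+1) := by
        by_cases h : 1 ≤ dl (s j) (T 2 (j+1) m)
        · left; exact (dl_pos _ _ h).symm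
        · right; exact (dl_pos _ _ (by omega)).symm
      obtain ⟨h1, h5⟩ := xor_step _ _ _ ⟨i1, i2⟩ hvw h4
      rw [← b2 j (by omega)] at h1 h5
      have h2 : ∀ a, 1 ≤ a → a ≤ 3 → cntL T a (m+1) 2 (j+1) = cntL T a m 2 (j+1) + dl (s (j+1)) a := by
        intro a ha ha3
        rw [cntL_succ' _ _ _ _ _ (by omega) (by omega) (by omega), cntL_succ' _ _ _ _ _ (by omega) (by omega) (by omega), ih _ ha ha3]
        have := h5 a
        omega
      exact ⟨⟨h1.1, h1.2, aux _ hj h1 h2⟩, h2⟩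
  have c2e : ∀ a, 1 ≤ a → a ≤ 3 → cntL T a (m+1) 3 0 = cntL T a m 3 0 + dl (s m) a + dl (T 2 (m+1) (m+1)) a := by
    intro a ha ha3
    rw [cntL_next, cntL_next, cntL_succ' _ _ _ _ _ (by omega) (by omega) (by omega), (c2 m le_rfl).2 a ha ha3]
  have b30 : T 3 1 (m+1) = s m ^^^ T 2 (m+1) (m+1) := by
    have hvw := hw 2 (m+1) (by omega) (by omega) (by omega) (by omega)
    have hvc := hw 3 1 (by omega) (by omega) (by omega) (by omega)
    obtain ⟨⟨i1, i2, i3⟩, -⟩ := c2 m le_rfl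
    have h3 := (hb _ hvc.1 hvc.2 3 (by omega) (by omega) 0 (by omega)).2
    rw [cntL_succ' _ _ _ _ _ (by omega) (by omega) (by omega), c2e _ hvc.1 hvc.2, dl_self] at h3
    apply xor_third _ _ _ ⟨i1, i2⟩ hvw hvc i3
    · intro h
      rw [← h, dl_self] at h3; omega
    · intro h
      rw [← h, dl_self] at h3; omega
  have c3 : ∀ j, j ≤ m → (∀ a, 1 ≤ a → a ≤ 3 → cntL T a (m+1) 3 (j+1) = cntL T a m 3 j + 1) ∧
      (∀ i, i < j → T 3 (i+2) (m+1) = T 3 (i+1) m) := by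
    intro j
    induction j with
    | zero =>
      intro _
      refine ⟨fun a ha ha3 => ?_, fun i hi => by omega⟩
      have hvw := hw 2 (m+1) (by omega) (by omega) (by omega) (by omega)
      obtain ⟨⟨i1, i2, i3⟩, -⟩ := c2 m le_rfl
      rw [cntL_succ' _ _ _ _ _ (by omega) (by omega) (by omega), c2e _ ha ha3, zero_add, b30]
      have := dl_third _ _ ⟨i1, i2⟩ hvw i3 a ha ha3
      omega
    | succ j ih =>
      intro hj
      obtain ⟨ih1, ih2⟩ := ih (by omega)
      have hvw := hw 3 (j+1+1) (by omega) (by omega) (by omega) (by omega)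
      have e : T 3 (j+1+1) (m+1) = T 3 (j+1) m := by
        have h1 := (hb _ hvw.1 hvw.2 3 (by omega) le_rfl (j+1) hj).2
        rw [cntL_succ' _ _ (m+1) _ (j+1) (by omega) (by omega) (by omega), cntL_succ' _ _ m _ _ (by omega) (by omega) (by omega),
          ih1 _ hvw.1 hvw.2, dl_self] at h1
        exact (dl_pos _ _ (by omega)).symm
      refine ⟨fun a ha ha3 => ?_, fun i hi => ?_⟩
      · rw [cntL_succ' _ _ (m+1) _ (j+1) (by omega) (by omega) (by omega), cntL_succ' _ _ m _ _ (by omega) (by omega) (by omega),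
          ih1 _ ha ha3, e]
        omega
      · rcases Nat.lt_succ_iff_lt_or_eq.mp hi with h | rfl
        · exact ih2 i h
        · exact e
  exact ⟨s0, (c1 m le_rfl).2, b2, fun j hj => (c2 j hj).1, b30, (c3 m le_rfl).2⟩

/-- structure implies bounds and totals -/
lemma str_bd (T : ℕ → ℕ → ℕ → ℕ) (m : ℕ) (hu : RowVal T m) (hw : RowVal T (m+1))
    (s : ℕ → ℕ) (h : RowStr T m s) :
    RowBd T m ∧ ∀ a, 1 ≤ a → a ≤ 3 → cntL T a (m+1) 3 (m+1) = cntL T a m 3 m + 1 := by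
  have c1 : ∀ a, ∀ j, j ≤ m → cntL T a (m+1) 1 j = cntL T a m 1 j := by
    intro a j
    induction j with
    | zero => intro _; rw [cntL_zero, cntL_zero]
    | succ j ih =>
      intro hj
      rw [cntL_succ' _ _ _ _ _ le_rfl (by omega) (by omega), cntL_succ' _ _ _ _ _ le_rfl (by omega) (by omega),
          ih (by omega), h.b1 j (by omega)]
  have c2 : ∀ a, ∀ j, j ≤ m → cntL T a (m+1) 2 j = cntL T a m 2 j + dl (s j) a := by
    intro a j
    induction j with
    | zero =>
      intro _
      rw [cntL_next, cntL_next, cntL_succ' _ _ _ _ _ le_rfl (by omega) (by omega), c1 a m le_rfl, h.s0]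
    | succ j ih =>
      intro hj
      have hvu := hu 2 (j+1) (by omega) (by omega) (by omega) hj
      have hvw := hw 2 (j+1) (by omega) (by omega) (by omega) (by omega)
      obtain ⟨i1, i2, i3⟩ := h.sv j (by omega)
      obtain ⟨k1, k2, -⟩ := h.sv (j+1) (by omega)
      have h4 := xor_two _ _ _ _ ⟨i1, i2⟩ hvw hvu ⟨k1, k2⟩ i3 (h.b2 j (by omega))
      have h5 := (xor_step _ _ _ ⟨i1, i2⟩ hvw h4).2 a
      rw [← h.b2 j (by omega)] at h5
      rw [cntL_succ' _ _ _ _ _ (by omega) (by omega) (by omega), cntL_succ' _ _ _ _ _ (by omega) (by omega) (by omega), ih (by omega)]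
      omega
  have c3 : ∀ a, 1 ≤ a → a ≤ 3 → ∀ j, j ≤ m → cntL T a (m+1) 3 (j+1) = cntL T a m 3 j + 1 := by
    intro a ha ha3 j
    induction j with
    | zero =>
      intro _
      have hvw := hw 2 (m+1) (by omega) (by omega) (by omega) (by omega)
      obtain ⟨i1, i2, i3⟩ := h.sv m le_rfl
      rw [cntL_succ' _ _ _ _ _ (by omega) (by omega) (by omega), cntL_next, cntL_next,
        cntL_succ' _ _ _ _ _ (by omega) (by omega) (by omega), c2 a m le_rfl, zero_add, h.b30]
      have := dl_third _ _ ⟨i1, i2⟩ hvw i3 a ha ha3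
      omega
    | succ j ih =>
      intro hj
      rw [cntL_succ' _ _ (m+1) _ (j+1) (by omega) (by omega) (by omega), cntL_succ' _ _ m _ _ (by omega) (by omega) (by omega),
          ih (by omega), h.b3 j (by omega)]
      omega
  refine ⟨?_, fun a ha ha3 => c3 a ha ha3 m le_rfl⟩
  intro a ha ha3 i hi hi3 j hj
  have hs := cntL_succ' T a (m+1) i j hi hi3 (by omega)
  have hd := dl_le (T i (j+1) (m+1)) a
  interval_cases i
  · have := c1 a j hj
    omega
  · have h2 := c2 a j hj
    obtain ⟨i1, i2, i3⟩ := h.sv j hj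
    have : dl (s j) a + dl (T 2 (j+1) (m+1)) a ≤ 1 := by
      unfold dl; split_ifs <;> omega
    omega
  · have := c3 a ha ha3 j hj
    omega

/-- xor of `f 0, …, f (k-1)` -/
def xs (f : ℕ → ℕ) : ℕ → ℕ
  | 0 => 0
  | k+1 => xs f k ^^^ f k

/-- array of a coloring -/
def toT (n : ℕ) (C : ℕ × ℕ → ℕ) (i j k : ℕ) : ℕ :=
  if 1 ≤ i ∧ i ≤ 3 ∧ 1 ≤ j ∧ j ≤ k ∧ k ≤ n then
    if i = 1 then C (j-1, 0) ^^^ C (j, 0)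
    else if i = 2 then C (k-j+1, j-1) ^^^ C (k-j, j)
    else C (0, k-j) ^^^ C (0, k-j+1)
  else 0

/-- the `s` values of an array -/
def sT (T : ℕ → ℕ → ℕ → ℕ) (m j : ℕ) : ℕ :=
  T 1 (m+1) (m+1) ^^^ (xs (fun i => T 2 (i+1) (m+1)) j ^^^ xs (fun i => T 2 (i+1) m) j)

/-- coloring of an array -/
def toC (n : ℕ) (c : ℕ) (T : ℕ → ℕ → ℕ → ℕ) (p : ℕ × ℕ) : ℕ :=
  if p.1 + p.2 ≤ n then
    c ^^^ (xs (fun i => T 1 (i+1) (i+1)) (p.1 + p.2) ^^^ xs (fun i => T 2 (i+1) (p.1 + p.2)) p.2)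
  else 0

lemma xor_val (a b : ℕ) (ha : a < 4) (hb : b < 4) (h : a ≠ b) : 1 ≤ a ^^^ b ∧ a ^^^ b ≤ 3 := by
  interval_cases a <;> interval_cases b <;> simp_all

lemma xor_lt4 (a b : ℕ) (ha : a < 4) (hb : b < 4) : a ^^^ b < 4 :=
  Nat.xor_lt_two_pow (n := 2) ha hb

lemma xor_ne_of (a b c : ℕ) (h : a ^^^ b = c) (hc : 1 ≤ c) : a ≠ b := by
  rintro rfl; rw [Nat.xor_self] at h; omega

lemma xor_mv (a b c : ℕ) (h : a ^^^ b = c) : b = a ^^^ c := by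
  rw [← h, ← Nat.xor_assoc, Nat.xor_self, Nat.zero_xor]

lemma xt1 (a b c d : ℕ) : a ^^^ d = a ^^^ b ^^^ (b ^^^ c) ^^^ (c ^^^ d) := by
  apply Nat.eq_of_testBit_eq; intro i
  simp only [Nat.testBit_xor]
  cases a.testBit i <;> cases b.testBit i <;> cases c.testBit i <;> cases d.testBit i <;> rfl

lemma xs_lt4 (f : ℕ → ℕ) (k : ℕ) (h : ∀ i, i < k → f i < 4) : xs f k < 4 := by
  induction k with
  | zero => simp [xs]
  | succ k ih => exact xor_lt4 _ _ (ih fun i hi => h i (by omega)) (h k (by omega))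

lemma sT_zero (T : ℕ → ℕ → ℕ → ℕ) (m : ℕ) : sT T m 0 = T 1 (m+1) (m+1) := by
  simp [sT, xs]

lemma xt2 (a b c d e : ℕ) : a ^^^ ((b ^^^ c) ^^^ (d ^^^ e)) = a ^^^ (b ^^^ d) ^^^ c ^^^ e := by
  apply Nat.eq_of_testBit_eq; intro i
  simp only [Nat.testBit_xor]
  cases a.testBit i <;> cases b.testBit i <;> cases c.testBit i <;> cases d.testBit i <;> cases e.testBit i <;> rfl

lemma sT_succ (T : ℕ → ℕ → ℕ → ℕ) (m j : ℕ) :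
    sT T m (j+1) = sT T m j ^^^ T 2 (j+1) (m+1) ^^^ T 2 (j+1) m := by
  simp only [sT, xs]
  exact xt2 _ _ _ _ _

lemma ITA_val (n : ℕ) (T : ℕ → ℕ → ℕ → ℕ) (hT : IsITA 3 n T) (k : ℕ) (hk : k ≤ n) : RowVal T k := by
  intro i j h1 h2 h3 h4
  have := hT.1 i j k h1 h2 h3 h4 hk
  rwa [mem_Icc] at this

lemma ITA_str (n : ℕ) (T : ℕ → ℕ → ℕ → ℕ) (hT : IsITA 3 n T) (m : ℕ) (hm : m + 1 ≤ n) :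
    RowStr T m (sT T m) :=
  bd_str T m (ITA_bd n T hT m hm) (ITA_val n T hT m (by omega)) (ITA_val n T hT _ hm) _ (sT_zero T m)
    (fun j _ => sT_succ T m j)

lemma toC_s (n c : ℕ) (T : ℕ → ℕ → ℕ → ℕ) (x y : ℕ) (h : x + y < n) :
    toC n c T (x, y) ^^^ toC n c T (x+1, y) = sT T (x+y) y := by
  have e : x + 1 + y = x + y + 1 := by omega
  simp only [toC, e, if_pos (show x + y ≤ n by omega), if_pos (show x + y + 1 ≤ n by omega), sT, xs]
  generalize xs (fun i => T 1 (i+1) (i+1)) (x+y) = A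
  generalize xs _ y = B
  generalize xs _ y = D
  generalize T 1 _ _ = E
  apply Nat.eq_of_testBit_eq; intro i
  simp only [Nat.testBit_xor]
  cases A.testBit i <;> cases B.testBit i <;> cases c.testBit i <;> cases D.testBit i <;> cases E.testBit i <;> rfl

lemma toC_w (n c : ℕ) (T : ℕ → ℕ → ℕ → ℕ) (x y : ℕ) (h : x + y < n) :
    toC n c T (x+1, y) ^^^ toC n c T (x, y+1) = T 2 (y+1) (x+y+1) := by
  have e : x + 1 + y = x + y + 1 := by omega
  have e' : x + (y + 1) = x + y + 1 := by omega
  simp only [toC, e, e', if_pos (show x + y + 1 ≤ n by omega)]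
  rw [xs.eq_2 _ y]
  generalize xs _ y = B
  generalize xs _ (x+y+1) = D
  generalize T 2 _ _ = E
  apply Nat.eq_of_testBit_eq; intro i
  simp only [Nat.testBit_xor]
  cases B.testBit i <;> cases c.testBit i <;> cases D.testBit i <;> cases E.testBit i <;> rfl

lemma xt3 (a b c : ℕ) : a ^^^ c = (a ^^^ b) ^^^ (b ^^^ c) := by
  apply Nat.eq_of_testBit_eq; intro i
  simp only [Nat.testBit_xor]
  cases a.testBit i <;> cases b.testBit i <;> cases c.testBit i <;> rfl

lemma toC_mem (n c : ℕ) (hc : c < 4) (T : ℕ → ℕ → ℕ → ℕ) (hT : IsITA 3 n T) : toC n c T ∈ ColorAll n := by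
  refine ⟨?_, ?_, ?_⟩
  · intro x y h
    simp only [toC, if_pos h]
    apply xor_lt4 _ _ hc
    apply xor_lt4
    · apply xs_lt4
      intro i hi
      have := ITA_val n T hT (i+1) (by omega) 1 (i+1) (by omega) (by omega) (by omega) (by omega)
      omega
    · apply xs_lt4
      intro i hi
      have := ITA_val n T hT (x+y) (by omega) 2 (i+1) (by omega) (by omega) (by omega) (by omega)
      omega
  · intro x y h
    obtain ⟨h1, h2, h3⟩ := (ITA_str n T hT (x+y) (by omega)).sv y (by omega)
    have hw := ITA_val n T hT (x+y+1) (by omega) 2 (y+1) (by omega) (by omega) (by omega) (by omega)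
    refine ⟨xor_ne_of _ _ _ (toC_s n c T x y h) h1, ?_, xor_ne_of _ _ _ (toC_w n c T x y h) hw.1⟩
    refine xor_ne_of _ _ _ ((xt3 _ (toC n c T (x+1, y)) _).trans (by rw [toC_s n c T x y h, toC_w n c T x y h])) 
      (xor_val _ _ (by omega) (by omega) h3).1
  · intro x y h
    simp only [toC, if_neg h]

lemma ITA_one (n : ℕ) (T : ℕ → ℕ → ℕ → ℕ) (hT : IsITA 3 n T) (j d : ℕ) (h : j + 1 + d ≤ n) :
    T 1 (j+1) (j+1+d) = T 1 (j+1) (j+1) := by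
  induction d with
  | zero => rfl
  | succ d ih =>
    rw [← ih (by omega)]
    exact (ITA_str n T hT (j+1+d) (by omega)).b1 j (by omega)

lemma ITA_three (n : ℕ) (T : ℕ → ℕ → ℕ → ℕ) (hT : IsITA 3 n T) (j d : ℕ) (h : j + 1 + d ≤ n) :
    T 3 (j+1) (j+1+d) = T 3 1 (d+1) := by
  induction j with
  | zero => rw [zero_add, add_comm]
  | succ j ih =>
    rw [← ih (by omega)]
    have := (ITA_str n T hT (j+1+d) (by omega)).b3 j (by omega)
    rw [show j + 1 + 1 + d = j + 1 + d + 1 by omega]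
    exact this

lemma toT_toC (n c : ℕ) (T : ℕ → ℕ → ℕ → ℕ) (hT : T ∈ ITAFull 3 n) : toT n (toC n c T) = T := by
  obtain ⟨hT, h0⟩ := hT
  funext i j k
  by_cases h : 1 ≤ i ∧ i ≤ 3 ∧ 1 ≤ j ∧ j ≤ k ∧ k ≤ n
  · simp only [toT, if_pos h]
    obtain ⟨hi, hi3, hj, hjk, hk⟩ := h
    obtain ⟨j, rfl⟩ : ∃ j', j = j' + 1 := ⟨j - 1, by omega⟩
    obtain ⟨d, rfl⟩ : ∃ d, k = j + 1 + d := ⟨k - (j + 1), by omega⟩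
    simp only [Nat.add_sub_cancel, Nat.add_sub_cancel_left]
    interval_cases i
    · rw [if_pos rfl, toC_s n c T j 0 (by omega), ITA_one n T hT j d hk, sT_zero]
    · rw [if_neg (by omega), if_pos rfl, toC_w n c T d j (by omega)]
      congr 1; omega
    · rw [if_neg (by omega), if_neg (by omega), ITA_three n T hT j d hk,
        xt3 _ (toC n c T (0+1, d)), toC_s n c T 0 d (by omega), toC_w n c T 0 d (by omega), zero_add,
        (ITA_str n T hT d (by omega)).b30]
  · simp only [toT, if_neg h]
    exact (h0 i j k h).symm

lemma toT_one (n : ℕ) (C : ℕ × ℕ → ℕ) (j k : ℕ) (h1 : j + 1 ≤ k) (h2 : k ≤ n) :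
    toT n C 1 (j+1) k = C (j, 0) ^^^ C (j+1, 0) := by
  unfold toT
  rw [if_pos (by omega), if_pos rfl, Nat.add_sub_cancel]

lemma toT_two (n : ℕ) (C : ℕ × ℕ → ℕ) (j k : ℕ) (h1 : j + 1 ≤ k) (h2 : k ≤ n) :
    toT n C 2 (j+1) k = C (k-j, j) ^^^ C (k-(j+1), j+1) := by
  unfold toT
  rw [if_pos (by omega), if_neg (by omega), if_pos rfl, Nat.add_sub_cancel,
    show k - (j+1) + 1 = k - j by omega]

lemma toT_three (n : ℕ) (C : ℕ × ℕ → ℕ) (j k : ℕ) (h1 : j + 1 ≤ k) (h2 : k ≤ n) :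
    toT n C 3 (j+1) k = C (0, k-(j+1)) ^^^ C (0, k-j) := by
  unfold toT
  rw [if_pos (by omega), if_neg (by omega), if_neg (by omega), show k - (j+1) + 1 = k - j by omega]

lemma toT_mem (n : ℕ) (C : ℕ × ℕ → ℕ) (hC : C ∈ ColorAll n) : toT n C ∈ ITAFull 3 n := by
  obtain ⟨hv, hp, h0⟩ := hC
  have t1 := toT_one n C
  have t2 := toT_two n C
  have t3 := toT_three n C
  have hval : ∀ k, k ≤ n → RowVal (toT n C) k := by
    intro k hk i j hi hi3 hj hjk
    obtain ⟨j, rfl⟩ : ∃ j', j = j' + 1 := ⟨j - 1, by omega⟩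
    interval_cases i
    · rw [t1 j k hjk hk]
      exact xor_val _ _ (hv _ _ (by omega)) (hv _ _ (by omega)) (hp j 0 (by omega)).1
    · rw [t2 j k hjk hk]
      have := (hp (k-(j+1)) j (by omega)).2.2
      rw [show k - (j+1) + 1 = k - j by omega] at this
      exact xor_val _ _ (hv _ _ (by omega)) (hv _ _ (by omega)) this
    · rw [t3 j k hjk hk]
      have := (hp 0 (k-(j+1)) (by omega)).2.1
      rw [show k - (j+1) + 1 = k - j by omega] at this
      exact xor_val _ _ (hv _ _ (by omega)) (hv _ _ (by omega)) this
  have hstr : ∀ m, m + 1 ≤ n → RowStr (toT n C) m (fun j => C (m-j, j) ^^^ C (m-j+1, j)) := by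
    intro m hm
    refine ⟨?_, ?_, ?_, ?_, ?_, ?_⟩
    · rw [t1 _ _ le_rfl hm]; simp
    · intro j hj
      rw [t1 _ _ (by omega) hm, t1 _ _ (by omega) (by omega)]
    · intro j hj
      rw [t2 _ _ (by omega) hm, t2 _ _ (by omega) (by omega)]
      rw [show m + 1 - (j+1) = m - j by omega, show m - (j+1) + 1 = m - j by omega, show m + 1 - j = m - j + 1 by omega]
      generalize C (m-j,j) = p
      generalize C (m-j+1,j) = q
      generalize C (m-j,j+1) = r
      generalize C (m-(j+1),j+1) = t
      apply Nat.eq_of_testBit_eq; intro i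
      simp only [Nat.testBit_xor]
      cases p.testBit i <;> cases q.testBit i <;> cases r.testBit i <;> cases t.testBit i <;> rfl
    · intro j hj
      have hh := hp (m-j) j (by omega)
      have h1 := xor_val _ _ (hv (m-j) j (by omega)) (hv (m-j+1) j (by omega)) hh.1
      refine ⟨h1.1, h1.2, ?_⟩
      rw [t2 _ _ (by omega) hm, show m + 1 - (j+1) = m - j by omega, show m + 1 - j = m - j + 1 by omega]
      intro he
      rw [Nat.xor_comm] at he
      exact hh.2.1 (Nat.xor_right_injective he)
    · rw [t2 _ _ le_rfl hm]
      have := t3 0 (m+1) (by omega) hm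
      simp only [zero_add, Nat.add_sub_cancel, Nat.sub_zero] at this
      rw [this]
      simp only [Nat.sub_self, Nat.add_sub_cancel_left]
      exact xt3 _ _ _
    · intro j hj
      rw [t3 (j+1) _ (by omega) hm, t3 _ _ (by omega) (by omega), show m + 1 - (j+1+1) = m - (j+1) by omega,
        show m + 1 - (j+1) = m - j by omega]
  refine ⟨bd_ITA n _ ?_ ?_ ?_, ?_⟩
  · intro i j k h1 h2 h3 h4 h5
    rw [mem_Icc]; exact hval k h5 i j h1 h2 h3 h4
  · intro m hm
    exact (str_bd _ m (hval m (by omega)) (hval _ hm) _ (hstr m hm)).1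
  · intro m hm
    exact (str_bd _ m (hval m (by omega)) (hval _ hm) _ (hstr m hm)).2
  · intro i j k h
    simp only [toT, if_neg h]

lemma toT_inj (n : ℕ) (C C' : ℕ × ℕ → ℕ) (hC : C ∈ ColorAll n) (hC' : C' ∈ ColorAll n)
    (h0 : C (0, 0) = C' (0, 0)) (h : toT n C = toT n C') : C = C' := by
  have hx : ∀ x, x ≤ n → C (x, 0) = C' (x, 0) := by
    intro x
    induction x with
    | zero => intro _; exact h0
    | succ x ih =>
      intro hx
      have h1 := congrFun (congrFun (congrFun h 1) (x+1)) n
      rw [toT_one _ _ _ _ hx le_rfl, toT_one _ _ _ _ hx le_rfl, ih (by omega)] at h1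
      exact Nat.xor_right_injective h1
  have hy : ∀ y x, x + y ≤ n → C (x, y) = C' (x, y) := by
    intro y
    induction y with
    | zero => intro x hx'; exact hx x hx'
    | succ y ih =>
      intro x hxy
      have h1 := congrFun (congrFun (congrFun h 2) (y+1)) (x+y+1)
      rw [toT_two _ _ _ _ (by omega) (by omega), toT_two _ _ _ _ (by omega) (by omega),
        show x + y + 1 - (y+1) = x by omega, show x + y + 1 - y = x + 1 by omega, ih (x+1) (by omega)] at h1
      exact Nat.xor_right_injective h1
  funext ⟨x, y⟩
  by_cases hxy : x + y ≤ n
  · exact hy y x hxy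
  · rw [hC.2.2 x y hxy, hC'.2.2 x y hxy]

/-- For every `n ≥ 1`, four times the number of interlacing triangular arrays of rank
`3` and height `n` equals the number of proper vertex `4`-colorings of `Δ_n`. -/
theorem four_ITA_eq_colorings (n : ℕ) (hn : 1 ≤ n) :
    4 * (ITAFull 3 n).ncard = (ColorAll n).ncard := by
  have h4 : (Set.Iio 4 : Set ℕ).ncard = 4 := by
    rw [← Finset.coe_Iio, Set.ncard_coe_finset]; rfl
  rw [← h4, ← Set.ncard_prod]
  symm
  refine Set.ncard_congr (fun C _ => (C (0, 0), toT n C)) ?_ ?_ ?_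
  · intro C hC
    exact ⟨hC.1 0 0 (by omega), toT_mem n C hC⟩
  · intro C C' hC hC' he
    rw [Prod.mk.injEq] at he
    exact toT_inj n C C' hC hC' he.1 he.2
  · rintro ⟨c, T⟩ ⟨hc, hT⟩
    refine ⟨toC n c T, toC_mem n c hc T hT.1, ?_⟩
    rw [toT_toC n c T hT]
    simp [toC, xs]
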